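/- (Weak solutions are weak-mild solutions.) Let $m > d/2 + 2$ and let $\mu \in C([0,T], \mathcal{P}(\mathbb{R}^d))$ be a weak solution of the McKean–Vlasov equation $\partial_t\mu_t = \frac{1}{2}\Delta\mu_t - \mathrm{div}[\mu_t(\Gamma*\mu_t)]$ with $\Gamma$ bounded Lipschitz. Then for every $h \in H^m(\mathbb{R}^d)$ (in particular for $h \in C_0^\infty$) and $t \in [0,T]$: $\langle\mu_t, h\rangle = \langle\mu_0, S_t h\rangle + \int_0^t \langle\mu_s, (\nabla S_{t-s}h)\cdot(\Gamma*\mu_s)\rangle\, ds$, where $(S_t)$ is the heat semigroup generated by $\Delta/2$. -/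

import Mathlib

open MeasureTheory
open scoped NNReal

/-- The heat semigroup on `ℝ^d` generated by `Δ/2`. -/
noncomputable def heatSemigroup (d : ℕ) (t : ℝ)
    (f : EuclideanSpace ℝ (Fin d) → ℝ) (x : EuclideanSpace ℝ (Fin d)) : ℝ :=
  if t = 0 then f x
  else ∫ y : EuclideanSpace ℝ (Fin d),
    ((2 * Real.pi * t) ^ (-(d : ℝ) / 2) * Real.exp (-‖y‖ ^ 2 / (2 * t))) * f (x - y)

/-- The Laplacian of `φ` at `x`, as the trace of the Hessian. -/
noncomputable def laplacian (d : ℕ) (φ : EuclideanSpace ℝ (Fin d) → ℝ)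
    (x : EuclideanSpace ℝ (Fin d)) : ℝ :=
  ∑ i : Fin d,
    (fderiv ℝ (fun y => fderiv ℝ φ y (EuclideanSpace.single i 1)) x)
      (EuclideanSpace.single i 1)


namespace MV

open Filter Topology

noncomputable def rho (d : ℕ) (z : EuclideanSpace ℝ (Fin d)) : ℝ :=
  (2 * Real.pi) ^ (-(d : ℝ) / 2) * Real.exp (-‖z‖ ^ 2 / 2)

noncomputable def P (d : ℕ) {F : Type*} [NormedAddCommGroup F] [NormedSpace ℝ F] (τ : ℝ)
    (g : EuclideanSpace ℝ (Fin d) → F) (x : EuclideanSpace ℝ (Fin d)) : F :=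
  ∫ z, rho d z • g (x - √τ • z)

variable {d : ℕ} {F : Type*} [NormedAddCommGroup F] [NormedSpace ℝ F]

lemma rho_cont : Continuous (rho d) := by
  unfold rho; fun_prop

lemma rho_nonneg (z : EuclideanSpace ℝ (Fin d)) : 0 ≤ rho d z := by
  unfold rho; positivity

lemma exp_int (b : ℝ) (hb : 0 < b) :
    Integrable (fun z : EuclideanSpace ℝ (Fin d) => Real.exp (-b * ‖z‖ ^ 2)) := by
  have := GaussianFourier.integrable_cexp_neg_mul_sq_norm_add (V := EuclideanSpace ℝ (Fin d))
    (b := (b : ℂ)) (by simpa using hb) 0 0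
  refine this.norm.congr (ae_of_all _ fun z => ?_)
  simp [Complex.norm_exp, ← Complex.ofReal_pow]

lemma rho_int : Integrable (rho d) := by
  refine ((exp_int (d := d) (1 / 2) (by norm_num)).const_mul
    ((2 * Real.pi) ^ (-(d : ℝ) / 2))).congr (ae_of_all _ fun z => ?_)
  simp only [rho]
  congr 2; ring

lemma rho_integral : ∫ z, rho d z = 1 := by
  have h := GaussianFourier.integral_rexp_neg_mul_sq_norm (V := EuclideanSpace ℝ (Fin d))
    (b := 1 / 2) (by norm_num)
  have e : ∀ z, rho d z = (2 * Real.pi) ^ (-(d : ℝ) / 2) * Real.exp (-(1 / 2) * ‖z‖ ^ 2) := by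
    intro z; simp only [rho]; congr 2; ring
  simp_rw [e]
  rw [integral_const_mul, h, finrank_euclideanSpace_fin]
  have : Real.pi / (1 / 2) = 2 * Real.pi := by ring
  rw [this, ← Real.rpow_add (by positivity)]
  ring_nf; simp

lemma rho_norm_int : Integrable (fun z => ‖z‖ * rho d z) := by
  refine Integrable.mono' (((exp_int (d := d) (1 / 4) (by norm_num)).const_mul
    (2 * (2 * Real.pi) ^ (-(d : ℝ) / 2)))) ?_ (ae_of_all _ fun z => ?_)
  · exact (continuous_norm.mul rho_cont).aestronglyMeasurable
  · rw [Real.norm_of_nonneg (mul_nonneg (norm_nonneg _) (rho_nonneg _))]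
    simp only [rho]
    have h1 : Real.exp (-‖z‖ ^ 2 / 2) = Real.exp (-(1/4) * ‖z‖ ^ 2) * Real.exp (-(1/4) * ‖z‖ ^ 2) := by
      rw [← Real.exp_add]; congr 1; ring
    have h2 : ‖z‖ * Real.exp (-(1/4) * ‖z‖ ^ 2) ≤ 2 := by
      have : Real.exp ((1/4) * ‖z‖ ^ 2) * Real.exp (-(1/4) * ‖z‖ ^ 2) = 1 := by
        rw [← Real.exp_add]; simp
      have h3 := Real.add_one_le_exp ((1/4) * ‖z‖ ^ 2)
      have h4 := Real.exp_pos (-(1/4) * ‖z‖ ^ 2)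
      have h5 : ‖z‖ ≤ 2 * Real.exp ((1/4) * ‖z‖ ^ 2) := by nlinarith [sq_nonneg (‖z‖ - 1)]
      nlinarith
    rw [h1]
    have h6 : 0 ≤ (2 * Real.pi) ^ (-(d : ℝ) / 2) * Real.exp (-(1/4) * ‖z‖ ^ 2) := by positivity
    nlinarith

lemma rho_hasFDerivAt (z : EuclideanSpace ℝ (Fin d)) :
    HasFDerivAt (rho d) (-(rho d z) • innerSL ℝ z) z := by
  have h1 : HasFDerivAt (fun z : EuclideanSpace ℝ (Fin d) => ‖z‖ ^ 2) (2 • innerSL ℝ z) z :=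
    (hasStrictFDerivAt_norm_sq z).hasFDerivAt
  have h2 := ((h1.const_mul (-1 / 2 : ℝ)).exp).const_mul ((2 * Real.pi) ^ (-(d : ℝ) / 2))
  have e : (fun z : EuclideanSpace ℝ (Fin d) => (2 * Real.pi) ^ (-(d : ℝ) / 2) *
      Real.exp (-1 / 2 * ‖z‖ ^ 2)) = rho d := by
    ext z; simp only [rho]; congr 2; ring
  rw [e] at h2
  refine h2.congr_fderiv ?_
  ext v
  have : rho d z = (2 * Real.pi) ^ (-(d : ℝ) / 2) * Real.exp (-1 / 2 * ‖z‖ ^ 2) := by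
    rw [← e]
  rw [this]
  simp
  ring

lemma P_integrable {g : EuclideanSpace ℝ (Fin d) → F} (hg : Continuous g) {K : ℝ}
    (hK : ∀ x, ‖g x‖ ≤ K) (τ : ℝ) (x : EuclideanSpace ℝ (Fin d)) :
    Integrable (fun z => rho d z • g (x - √τ • z)) := by
  refine Integrable.mono' (rho_int.mul_const K) ?_ (ae_of_all _ fun z => ?_)
  · exact (rho_cont.smul (hg.comp (by fun_prop))).aestronglyMeasurable
  · rw [norm_smul, Real.norm_of_nonneg (rho_nonneg _)]
    exact mul_le_mul_of_nonneg_left (hK _) (rho_nonneg _)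

lemma P_continuous {g : EuclideanSpace ℝ (Fin d) → F} (hg : Continuous g) {K : ℝ}
    (hK : ∀ x, ‖g x‖ ≤ K) :
    Continuous (fun p : ℝ × EuclideanSpace ℝ (Fin d) => P d p.1 g p.2) := by
  unfold P
  refine continuous_of_dominated (bound := fun z => rho d z * K) (fun p => ?_) (fun p => ?_)
    (rho_int.mul_const K) (ae_of_all _ fun z => ?_)
  · exact (P_integrable hg hK _ _).aestronglyMeasurable
  · refine ae_of_all _ fun z => ?_
    rw [norm_smul, Real.norm_of_nonneg (rho_nonneg _)]
    exact mul_le_mul_of_nonneg_left (hK _) (rho_nonneg _)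
  · exact continuous_const.smul (hg.comp (by fun_prop))

lemma P_bound {g : EuclideanSpace ℝ (Fin d) → F} {K : ℝ}
    (hK : ∀ x, ‖g x‖ ≤ K) (τ : ℝ) (x : EuclideanSpace ℝ (Fin d)) : ‖P d τ g x‖ ≤ K := by
  calc ‖P d τ g x‖ ≤ ∫ z, rho d z * K := by
        refine norm_integral_le_of_norm_le (rho_int.mul_const K) (ae_of_all _ fun z => ?_)
        rw [norm_smul, Real.norm_of_nonneg (rho_nonneg _)]
        exact mul_le_mul_of_nonneg_left (hK _) (rho_nonneg _)
    _ = K := by rw [integral_mul_const, rho_integral, one_mul]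

lemma P_hasFDerivAt {g : EuclideanSpace ℝ (Fin d) → F} (hg : ContDiff ℝ 1 g) {K K' : ℝ}
    (hK : ∀ x, ‖g x‖ ≤ K) (hK' : ∀ x, ‖fderiv ℝ g x‖ ≤ K') (τ : ℝ)
    (x : EuclideanSpace ℝ (Fin d)) :
    HasFDerivAt (P d τ g) (P d τ (fderiv ℝ g) x) x := by
  have hc : Continuous (fderiv ℝ g) := hg.continuous_fderiv (by norm_num)
  unfold P
  refine hasFDerivAt_integral_of_dominated_of_fderiv_le (s := Set.univ)
    (bound := fun z => rho d z * K')
    (F' := fun x z => rho d z • fderiv ℝ g (x - √τ • z)) univ_mem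
    (Eventually.of_forall fun y => (P_integrable hg.continuous hK _ _).aestronglyMeasurable)
    (P_integrable hg.continuous hK _ _)
    (P_integrable hc hK' _ _).aestronglyMeasurable
    (ae_of_all _ fun z y _ => ?_) (rho_int.mul_const K') (ae_of_all _ fun z y _ => ?_)
  · rw [norm_smul, Real.norm_of_nonneg (rho_nonneg _)]
    exact mul_le_mul_of_nonneg_left (hK' _) (rho_nonneg _)
  · have h1 : HasFDerivAt (fun y => g (y - √τ • z)) (fderiv ℝ g (y - √τ • z)) y := by
      have := (hg.differentiable (by norm_num) (y - √τ • z)).hasFDerivAt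
      exact (hasFDerivAt_comp_sub (√τ • z)).2 this
    exact h1.const_smul (rho d z)

lemma heat_eq {τ : ℝ} (hτ : 0 ≤ τ) (f : EuclideanSpace ℝ (Fin d) → ℝ) :
    heatSemigroup d τ f = P d τ f := by
  ext x
  rcases hτ.eq_or_lt with rfl | hτ
  · simp [heatSemigroup, P, integral_mul_const, rho_integral]
  · have hs : 0 < √τ := Real.sqrt_pos.2 hτ
    have h := Measure.integral_comp_smul (volume : Measure (EuclideanSpace ℝ (Fin d)))
      (fun y => ((2 * Real.pi * τ) ^ (-(d : ℝ) / 2) * Real.exp (-‖y‖ ^ 2 / (2 * τ))) * f (x - y)) (√τ)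
    rw [heatSemigroup, if_neg hτ.ne', P]
    rw [finrank_euclideanSpace_fin, abs_of_pos (by positivity), smul_eq_mul] at h
    have h3 : √τ ^ d * (√τ ^ d)⁻¹ = 1 := mul_inv_cancel₀ (by positivity)
    rw [← one_mul (∫ y, _), ← h3, mul_assoc, ← h, ← integral_const_mul]
    congr 1; ext z
    have h4 : √τ ^ d = τ ^ ((d : ℝ) / 2) := by
      rw [Real.sqrt_eq_rpow, ← Real.rpow_natCast, ← Real.rpow_mul hτ.le]; congr 1; ring
    have h5 : (2 * Real.pi * τ) ^ (-(d : ℝ) / 2) * √τ ^ d = (2 * Real.pi) ^ (-(d : ℝ) / 2) := by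
      rw [h4, Real.mul_rpow (by positivity) hτ.le, mul_assoc, ← Real.rpow_add hτ]
      ring_nf; simp
    have h6 : -‖√τ • z‖ ^ 2 / (2 * τ) = -‖z‖ ^ 2 / 2 := by
      rw [norm_smul, Real.norm_of_nonneg hs.le, mul_pow, Real.sq_sqrt hτ.le]; field_simp
    rw [h6, smul_eq_mul, rho, ← h5]; ring

lemma lap_eq {h : EuclideanSpace ℝ (Fin d) → ℝ} (hC : ContDiff ℝ 2 h)
    (x : EuclideanSpace ℝ (Fin d)) :
    laplacian d h x = ∑ i : Fin d, fderiv ℝ (fderiv ℝ h) x (EuclideanSpace.single i 1)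
      (EuclideanSpace.single i 1) := by
  unfold laplacian
  refine Finset.sum_congr rfl fun i _ => ?_
  have h1 : ContDiff ℝ 1 (fderiv ℝ h) := hC.fderiv_right (by norm_num)
  have h2 := (h1.differentiable (by norm_num) x).hasFDerivAt
  have h3 := h2.clm_apply (hasFDerivAt_const (EuclideanSpace.single i (1 : ℝ)) x)
  rw [h3.fderiv]
  simp

lemma stein {h : EuclideanSpace ℝ (Fin d) → ℝ} (hC : ContDiff ℝ 2 h) {K1 K2 : ℝ}
    (hK1 : ∀ x, ‖fderiv ℝ h x‖ ≤ K1) (hK2 : ∀ x, ‖fderiv ℝ (fderiv ℝ h) x‖ ≤ K2) (τ : ℝ)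
    (x : EuclideanSpace ℝ (Fin d)) (i : Fin d) :
    ∫ z, rho d z * (z i * fderiv ℝ h (x - √τ • z) (EuclideanSpace.single i 1)) =
      -√τ * ∫ z, rho d z * fderiv ℝ (fderiv ℝ h) (x - √τ • z) (EuclideanSpace.single i 1)
        (EuclideanSpace.single i 1) := by
  set e : EuclideanSpace ℝ (Fin d) := EuclideanSpace.single i 1 with he
  have hne : ‖e‖ = 1 := by simp [he]
  have h1 : ContDiff ℝ 1 (fderiv ℝ h) := hC.fderiv_right (by norm_num)
  have hc1 : Continuous (fderiv ℝ h) := h1.continuous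
  have hc2 : Continuous (fderiv ℝ (fderiv ℝ h)) := h1.continuous_fderiv (by norm_num)
  have hg : ∀ z, HasFDerivAt (fun z => fderiv ℝ h (x - √τ • z) e)
      (-√τ • (fderiv ℝ (fderiv ℝ h) (x - √τ • z)).flip e) z := by
    intro z
    have h2 := (h1.differentiable (by norm_num) (x - √τ • z)).hasFDerivAt
    have h3 : HasFDerivAt (fun z : EuclideanSpace ℝ (Fin d) => x - √τ • z)
      (-(√τ • ContinuousLinearMap.id ℝ _)) z := ((hasFDerivAt_id z).const_smul √τ).const_sub x
    have h4 := (h2.comp z h3).clm_apply (hasFDerivAt_const e z)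
    refine h4.congr_fderiv ?_
    ext v
    simp
  have hr : ∀ z, fderiv ℝ (rho d) z e = -(rho d z * z i) := by
    intro z
    rw [(rho_hasFDerivAt z).fderiv]
    simp [he, EuclideanSpace.inner_single_right]
  have hg' : ∀ z, fderiv ℝ (fun z => fderiv ℝ h (x - √τ • z) e) z e =
      -√τ * fderiv ℝ (fderiv ℝ h) (x - √τ • z) e e := by
    intro z
    rw [(hg z).fderiv]; simp
  have b1 : ∀ z, ‖fderiv ℝ h (x - √τ • z) e‖ ≤ K1 := fun z => by
    refine (ContinuousLinearMap.le_opNorm _ _).trans ?_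
    rw [hne, mul_one]; exact hK1 _
  have b2 : ∀ z, ‖fderiv ℝ (fderiv ℝ h) (x - √τ • z) e e‖ ≤ K2 := fun z => by
    refine (ContinuousLinearMap.le_opNorm₂ _ _ _).trans ?_
    rw [hne, mul_one, mul_one]; exact hK2 _
  have key := integral_mul_fderiv_eq_neg_fderiv_mul_of_integrable
    (μ := (volume : Measure (EuclideanSpace ℝ (Fin d)))) (f := rho d)
    (g := fun z => fderiv ℝ h (x - √τ • z) e) (v := e) ?_ ?_ ?_
    (fun z _ => (rho_hasFDerivAt z).differentiableAt) (fun z _ => (hg z).differentiableAt)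
  · simp_rw [hg', hr] at key
    rw [← integral_neg] at key
    rw [← integral_const_mul]
    calc _ = _ := ?_
      _ = _ := key.symm
      _ = _ := ?_
    · congr 1; ext z; ring
    · congr 1; ext z; ring
  · simp_rw [hr]
    refine Integrable.mono' (rho_norm_int.mul_const K1) ?_ (ae_of_all _ fun z => ?_)
    · refine Continuous.aestronglyMeasurable ?_
      refine Continuous.mul (rho_cont.mul (by fun_prop)).neg ?_
      exact (hc1.comp (by fun_prop)).clm_apply continuous_const
    · rw [norm_mul, norm_neg, norm_mul, Real.norm_of_nonneg (rho_nonneg _), mul_comm (rho d z)]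
      refine mul_le_mul (mul_le_mul_of_nonneg_right (PiLp.norm_apply_le z i) (rho_nonneg _)) (b1 z)
        (norm_nonneg _) (mul_nonneg (norm_nonneg _) (rho_nonneg _))
  · simp_rw [hg']
    refine Integrable.mono' (rho_int.mul_const (√τ * K2)) ?_ (ae_of_all _ fun z => ?_)
    · refine Continuous.aestronglyMeasurable ?_
      refine Continuous.mul rho_cont (continuous_const.mul ?_)
      exact ((hc2.comp (by fun_prop)).clm_apply continuous_const).clm_apply continuous_const
    · rw [norm_mul, norm_mul, norm_neg, Real.norm_of_nonneg (rho_nonneg _),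
        Real.norm_of_nonneg (Real.sqrt_nonneg τ)]
      exact mul_le_mul_of_nonneg_left (mul_le_mul_of_nonneg_left (b2 z) (Real.sqrt_nonneg τ))
        (rho_nonneg _)
  · refine Integrable.mono' (rho_int.mul_const K1) ?_ (ae_of_all _ fun z => ?_)
    · refine Continuous.aestronglyMeasurable ?_
      refine Continuous.mul rho_cont ?_
      exact (hc1.comp (by fun_prop)).clm_apply continuous_const
    · rw [norm_mul, Real.norm_of_nonneg (rho_nonneg _)]
      exact mul_le_mul_of_nonneg_left (b1 z) (rho_nonneg _)

lemma decomp (L : EuclideanSpace ℝ (Fin d) →L[ℝ] ℝ) (z : EuclideanSpace ℝ (Fin d)) :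
    L z = ∑ i, z i * L (EuclideanSpace.single i 1) := by
  have h : z = ∑ i, z i • EuclideanSpace.single i (1 : ℝ) := by
    ext j; simp [Finset.sum_apply, Pi.single_apply]
  conv_lhs => rw [h]
  simp

lemma P_time {h : EuclideanSpace ℝ (Fin d) → ℝ} (hC : ContDiff ℝ 2 h) {K0 K1 K2 : ℝ}
    (hK0 : ∀ x, ‖h x‖ ≤ K0)
    (hK1 : ∀ x, ‖fderiv ℝ h x‖ ≤ K1) (hK2 : ∀ x, ‖fderiv ℝ (fderiv ℝ h) x‖ ≤ K2) {τ : ℝ}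
    (hτ : 0 < τ) (x : EuclideanSpace ℝ (Fin d)) :
    HasDerivAt (fun τ => P d τ h x) (1 / 2 * P d τ (laplacian d h) x) τ := by
  have h1 : ContDiff ℝ 1 (fderiv ℝ h) := hC.fderiv_right (by norm_num)
  have hc1 : Continuous (fderiv ℝ h) := h1.continuous
  have hc2 : Continuous (fderiv ℝ (fderiv ℝ h)) := h1.continuous_fderiv (by norm_num)
  have hs : 0 < √τ := Real.sqrt_pos.2 hτ
  have hs2 : 0 < √(τ / 2) := Real.sqrt_pos.2 (by positivity)
  have hK1' : 0 ≤ K1 := (norm_nonneg _).trans (hK1 0)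
  have key := hasDerivAt_integral_of_dominated_loc_of_deriv_le
    (μ := (volume : Measure (EuclideanSpace ℝ (Fin d)))) (x₀ := τ) (s := Set.Ioi (τ / 2))
    (F := fun τ z => rho d z • h (x - √τ • z))
    (F' := fun τ z => rho d z • fderiv ℝ h (x - √τ • z) (-(1 / (2 * √τ)) • z))
    (bound := fun z => ‖z‖ * rho d z * (K1 * (1 / (2 * √(τ / 2)))))
    (Ioi_mem_nhds (by linarith))
    (Eventually.of_forall fun y => (P_integrable hC.continuous hK0 _ _).aestronglyMeasurable)
    (P_integrable hC.continuous hK0 _ _) ?_ (ae_of_all _ fun z r hr => ?_)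
    (rho_norm_int.mul_const _) (ae_of_all _ fun z r hr => ?_)
  · refine key.2.congr_deriv ?_
    have e1 : ∀ z, rho d z • fderiv ℝ h (x - √τ • z) (-(1 / (2 * √τ)) • z) =
        ∑ i, -(1 / (2 * √τ)) * (rho d z *
          (z i * fderiv ℝ h (x - √τ • z) (EuclideanSpace.single i 1))) := by
      intro z
      rw [map_smul, decomp (fderiv ℝ h (x - √τ • z)) z, smul_eq_mul, smul_eq_mul,
        Finset.mul_sum, Finset.mul_sum]
      refine Finset.sum_congr rfl fun i _ => by ring
    simp_rw [e1]
    unfold P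
    simp_rw [lap_eq hC, smul_eq_mul, Finset.mul_sum]
    rw [integral_finsetSum, integral_finsetSum, Finset.mul_sum]
    · refine Finset.sum_congr rfl fun i _ => ?_
      rw [integral_const_mul, stein hC hK1 hK2]
      field_simp
    · intro i _
      refine P_integrable (g := fun y => fderiv ℝ (fderiv ℝ h) y (EuclideanSpace.single i 1)
        (EuclideanSpace.single i 1)) (K := K2) ?_ (fun y => ?_) τ x
      · exact (hc2.clm_apply continuous_const).clm_apply continuous_const
      · refine (ContinuousLinearMap.le_opNorm₂ _ _ _).trans ?_
        simpa using hK2 y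
    · intro i _
      refine Integrable.const_mul ?_ _
      refine Integrable.mono' (rho_norm_int.mul_const K1) ?_ (ae_of_all _ fun z => ?_)
      · refine Continuous.aestronglyMeasurable ?_
        refine Continuous.mul rho_cont (Continuous.mul (by fun_prop) ?_)
        exact (hc1.comp (by fun_prop)).clm_apply continuous_const
      · rw [← mul_assoc, norm_mul, norm_mul, Real.norm_of_nonneg (rho_nonneg _),
          mul_comm (rho d z)]
        refine mul_le_mul (mul_le_mul_of_nonneg_right (PiLp.norm_apply_le z i) (rho_nonneg _)) ?_
          (norm_nonneg _) (mul_nonneg (norm_nonneg _) (rho_nonneg _))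
        refine (ContinuousLinearMap.le_opNorm _ _).trans ?_
        simpa using hK1 _
  · refine Continuous.aestronglyMeasurable ?_
    refine Continuous.smul rho_cont ?_
    exact (hc1.comp (by fun_prop)).clm_apply (by fun_prop)
  · have hr' : τ / 2 < r := hr
    have hr0 : √(τ / 2) ≤ √r := Real.sqrt_le_sqrt hr'.le
    have hr1 : 0 < √r := hs2.trans_le hr0
    rw [norm_smul, Real.norm_of_nonneg (rho_nonneg _), mul_comm ‖z‖, mul_assoc]
    refine mul_le_mul_of_nonneg_left ?_ (rho_nonneg _)
    refine (ContinuousLinearMap.le_opNorm _ _).trans ?_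
    rw [norm_smul, norm_neg, Real.norm_of_nonneg (by positivity)]
    calc _ ≤ K1 * (1 / (2 * √(τ / 2)) * ‖z‖) := by
          gcongr
          exact hK1 _
      _ = _ := by ring
  · have hr' : τ / 2 < r := hr
    have hr0 : 0 < r := by linarith
    have h2 := (hC.differentiable (by norm_num) (x - √r • z)).hasFDerivAt
    have h3 : HasDerivAt (fun r => x - √r • z) (-(1 / (2 * √r)) • z) r := by
      have := ((Real.hasDerivAt_sqrt hr0.ne').smul_const z).const_sub x
      simpa using this
    exact (h2.comp_hasDerivAt r h3).const_smul (rho d z)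

lemma lap_cont {h : EuclideanSpace ℝ (Fin d) → ℝ} (hC : ContDiff ℝ 2 h) :
    Continuous (laplacian d h) := by
  have h1 : ContDiff ℝ 1 (fderiv ℝ h) := hC.fderiv_right (by norm_num)
  have hc2 : Continuous (fderiv ℝ (fderiv ℝ h)) := h1.continuous_fderiv (by norm_num)
  rw [funext (lap_eq hC)]
  exact continuous_finsetSum _ fun i _ =>
    (hc2.clm_apply continuous_const).clm_apply continuous_const

lemma lap_bound {h : EuclideanSpace ℝ (Fin d) → ℝ} (hC : ContDiff ℝ 2 h) {K2 : ℝ}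
    (hK2 : ∀ x, ‖fderiv ℝ (fderiv ℝ h) x‖ ≤ K2) (x) : ‖laplacian d h x‖ ≤ d * K2 := by
  rw [lap_eq hC]
  refine (norm_sum_le_of_le (n := fun _ : Fin d => K2) _ fun i _ => ?_).trans (by simp)
  refine (ContinuousLinearMap.le_opNorm₂ _ _ _).trans ?_
  simpa using hK2 x

/-- C²_b is preserved. -/
lemma P_props {h : EuclideanSpace ℝ (Fin d) → ℝ} (hC : ContDiff ℝ 2 h) {K0 K1 K2 : ℝ}
    (hK0 : ∀ x, ‖h x‖ ≤ K0)
    (hK1 : ∀ x, ‖fderiv ℝ h x‖ ≤ K1) (hK2 : ∀ x, ‖fderiv ℝ (fderiv ℝ h) x‖ ≤ K2) (τ : ℝ) :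
    ContDiff ℝ 2 (P d τ h) ∧ fderiv ℝ (P d τ h) = P d τ (fderiv ℝ h) ∧
    (∀ x, laplacian d (P d τ h) x = P d τ (laplacian d h) x) ∧
    (∀ i : ℕ, i ≤ 2 → ∃ K, ∀ x, ‖iteratedFDeriv ℝ i (P d τ h) x‖ ≤ K) := by
  have h1 : ContDiff ℝ 1 (fderiv ℝ h) := hC.fderiv_right (by norm_num)
  have hc1 : Continuous (fderiv ℝ h) := h1.continuous
  have hc2 : Continuous (fderiv ℝ (fderiv ℝ h)) := h1.continuous_fderiv (by norm_num)
  have d1 : ∀ x, HasFDerivAt (P d τ h) (P d τ (fderiv ℝ h) x) x :=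
    P_hasFDerivAt (hC.of_le (by norm_num)) hK0 hK1 τ
  have d2 : ∀ x, HasFDerivAt (P d τ (fderiv ℝ h)) (P d τ (fderiv ℝ (fderiv ℝ h)) x) x :=
    P_hasFDerivAt h1 hK1 hK2 τ
  have e1 : fderiv ℝ (P d τ h) = P d τ (fderiv ℝ h) := funext fun x => (d1 x).fderiv
  have e2 : fderiv ℝ (P d τ (fderiv ℝ h)) = P d τ (fderiv ℝ (fderiv ℝ h)) :=
    funext fun x => (d2 x).fderiv
  have hcP : ContDiff ℝ 2 (P d τ h) := by
    have a1 : ContDiff ℝ 1 (P d τ (fderiv ℝ h)) := by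
      rw [contDiff_one_iff_fderiv]
      refine ⟨fun x => (d2 x).differentiableAt, ?_⟩
      rw [e2]
      exact (P_continuous hc2 hK2).comp (by fun_prop : Continuous fun x => (τ, x))
    have : (2 : WithTop ℕ∞) = 1 + 1 := by norm_num
    rw [this, contDiff_succ_iff_fderiv]
    refine ⟨fun x => (d1 x).differentiableAt, by simp, ?_⟩
    rw [e1]; exact a1
  refine ⟨hcP, e1, fun x => ?_, fun i hi => ?_⟩
  · rw [lap_eq hcP, e1, e2]
    unfold P
    simp_rw [lap_eq hC, smul_eq_mul, Finset.mul_sum]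
    rw [integral_finsetSum]
    · refine Finset.sum_congr rfl fun i _ => ?_
      have hI := P_integrable (g := fderiv ℝ (fderiv ℝ h)) hc2 hK2 τ x
      rw [ContinuousLinearMap.integral_apply hI, ContinuousLinearMap.integral_apply]
      · simp
      · exact hI.apply_continuousLinearMap _
    · intro i _
      refine P_integrable (g := fun y => fderiv ℝ (fderiv ℝ h) y (EuclideanSpace.single i 1)
        (EuclideanSpace.single i 1)) (K := K2) ?_ (fun y => ?_) τ x
      · exact (hc2.clm_apply continuous_const).clm_apply continuous_const
      · refine (ContinuousLinearMap.le_opNorm₂ _ _ _).trans ?_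
        simpa using hK2 y
  · interval_cases i
    · exact ⟨K0, fun x => by rw [norm_iteratedFDeriv_zero]; exact P_bound hK0 τ x⟩
    · exact ⟨K1, fun x => by
        rw [← norm_iteratedFDeriv_fderiv, norm_iteratedFDeriv_zero, e1]; exact P_bound hK1 τ x⟩
    · exact ⟨K2, fun x => by
        rw [← norm_iteratedFDeriv_fderiv, ← norm_iteratedFDeriv_fderiv, norm_iteratedFDeriv_zero,
          e1, e2]; exact P_bound hK2 τ x⟩

lemma int_cont {X Y : Type*} [TopologicalSpace X] [TopologicalSpace Y]
    [MeasurableSpace X] [MeasurableSpace Y] [BorelSpace X] [BorelSpace Y]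
    [SecondCountableTopology X] [SecondCountableTopology Y]
    [TopologicalSpace.PseudoMetrizableSpace X] [TopologicalSpace.PseudoMetrizableSpace Y]
    {m : Y → ProbabilityMeasure X} (hm : Continuous m) {f : Y × X → ℝ} (hf : Continuous f)
    {K : ℝ} (hK : ∀ p, ‖f p‖ ≤ K) :
    Continuous (fun y => ∫ x, f (y, x) ∂(m y : Measure X)) := by
  have h1 : Continuous (fun y => (diracProba y).prod (m y)) :=
    ProbabilityMeasure.continuous_prod.comp (continuous_diracProba.prodMk hm)
  have h2 := ProbabilityMeasure.continuous_iff_forall_continuous_integral.1 h1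
    (BoundedContinuousFunction.ofNormedAddCommGroup f hf K hK)
  refine h2.congr fun y => ?_
  have : ((diracProba y).prod (m y) : Measure (Y × X)) =
      (m y : Measure X).map (Prod.mk y) := by
    rw [ProbabilityMeasure.toMeasure_prod]
    exact Measure.dirac_prod y
  rw [this, integral_map (by fun_prop)
    (BoundedContinuousFunction.continuous _).aestronglyMeasurable]
  rfl

lemma main (T : ℝ)
    (ν : ℝ → ProbabilityMeasure (EuclideanSpace ℝ (Fin d))) (hν : Continuous ν)
    (Γ : EuclideanSpace ℝ (Fin d) → EuclideanSpace ℝ (Fin d) → EuclideanSpace ℝ (Fin d))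
    (KΓ : ℝ) (hΓbdd : ∀ x y, ‖Γ x y‖ ≤ KΓ)
    (hΓc : Continuous fun p : EuclideanSpace ℝ (Fin d) × EuclideanSpace ℝ (Fin d) => Γ p.1 p.2)
    (hweak : ∀ φ : EuclideanSpace ℝ (Fin d) → ℝ, ContDiff ℝ 2 φ →
      (∀ i : ℕ, i ≤ 2 → ∃ K, ∀ x, ‖iteratedFDeriv ℝ i φ x‖ ≤ K) →
      ∀ t ∈ Set.Icc (0 : ℝ) T,
        ∫ x, φ x ∂(ν t : Measure _) = (∫ x, φ x ∂(ν 0 : Measure _)) +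
          ∫ s in (0 : ℝ)..t,
            ∫ x, (1 / 2 * laplacian d φ x
              + (fderiv ℝ φ x) (∫ y, Γ x y ∂(ν s : Measure _))) ∂(ν s : Measure _))
    {h : EuclideanSpace ℝ (Fin d) → ℝ} (hC : ContDiff ℝ 2 h) {K0 K1 K2 : ℝ}
    (hK0 : ∀ x, ‖h x‖ ≤ K0)
    (hK1 : ∀ x, ‖fderiv ℝ h x‖ ≤ K1) (hK2 : ∀ x, ‖fderiv ℝ (fderiv ℝ h) x‖ ≤ K2)
    (t : ℝ) (ht : t ∈ Set.Icc (0 : ℝ) T) :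
    ∫ x, P d 0 h x ∂(ν t : Measure _) = (∫ x, P d t h x ∂(ν 0 : Measure _)) +
      ∫ s in (0 : ℝ)..t, ∫ x, (P d (t - s) (fderiv ℝ h) x) (∫ y, Γ x y ∂(ν s : Measure _))
        ∂(ν s : Measure _) := by
  have h1 : ContDiff ℝ 1 (fderiv ℝ h) := hC.fderiv_right (by norm_num)
  have hc1 : Continuous (fderiv ℝ h) := h1.continuous
  have hK1' : 0 ≤ K1 := (norm_nonneg _).trans (hK1 0)
  have hlc := lap_cont hC
  have hlb := lap_bound hC hK2
  set KL : ℝ := d * K2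
  -- continuity facts
  have cP0 : ∀ τ, Continuous (P d τ h) := fun τ =>
    (P_continuous hC.continuous hK0).comp (by fun_prop : Continuous fun x => (τ, x))
  have cPL : ∀ τ, Continuous (P d τ (laplacian d h)) := fun τ =>
    (P_continuous hlc hlb).comp (by fun_prop : Continuous fun x => (τ, x))
  have cP1 : ∀ τ, Continuous (P d τ (fderiv ℝ h)) := fun τ =>
    (P_continuous hc1 hK1).comp (by fun_prop : Continuous fun x => (τ, x))
  have bI : ∀ (r : ℝ) {f : EuclideanSpace ℝ (Fin d) → ℝ} (_ : Continuous f) {K : ℝ}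
      (_ : ∀ x, ‖f x‖ ≤ K), Integrable f (ν r : Measure _) := fun r f hf K hK =>
    Integrable.of_bound hf.aestronglyMeasurable K (ae_of_all _ hK)
  have iΓ : ∀ r x, Integrable (Γ x) (ν r : Measure _) := fun r x =>
    Integrable.of_bound
      (hΓc.comp (by fun_prop : Continuous fun y => (x, y))).aestronglyMeasurable KΓ
      (ae_of_all _ (hΓbdd x))
  have cΓ : ∀ r, Continuous fun x => ∫ y, Γ x y ∂(ν r : Measure _) := fun r => by
    refine continuous_of_dominated (bound := fun _ => KΓ) (fun x => (iΓ r x).aestronglyMeasurable)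
      (fun x => ae_of_all _ (hΓbdd x)) (integrable_const _) (ae_of_all _ fun y => ?_)
    exact hΓc.comp (by fun_prop : Continuous fun x => (x, y))
  have bΓ : ∀ r x, ‖∫ y, Γ x y ∂(ν r : Measure _)‖ ≤ KΓ := fun r x => by
    refine (norm_integral_le_of_norm_le (integrable_const KΓ) (ae_of_all _ (hΓbdd x))).trans ?_
    simp
  let H : ℝ → ℝ → ℝ := fun a r => ∫ x, P d (t - a) h x ∂(ν r : Measure _)
  let L : ℝ → ℝ → ℝ := fun a r => ∫ x, P d (t - a) (laplacian d h) x ∂(ν r : Measure _)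
  let D : ℝ → ℝ → ℝ := fun a r => ∫ x, (P d (t - a) (fderiv ℝ h) x)
    (∫ y, Γ x y ∂(ν r : Measure _)) ∂(ν r : Measure _)
  have cH : Continuous fun p : ℝ × ℝ => H p.1 p.2 :=
    int_cont (Y := ℝ × ℝ) (m := fun p => ν p.2) (hν.comp continuous_snd)
      (f := fun q => P d (t - q.1.1) h q.2)
      ((P_continuous hC.continuous hK0).comp
        (by fun_prop : Continuous fun q : (ℝ × ℝ) × EuclideanSpace ℝ (Fin d) =>
          (t - q.1.1, q.2))) (fun q => P_bound hK0 _ _)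
  have cL : Continuous fun p : ℝ × ℝ => L p.1 p.2 :=
    int_cont (Y := ℝ × ℝ) (m := fun p => ν p.2) (hν.comp continuous_snd)
      (f := fun q => P d (t - q.1.1) (laplacian d h) q.2)
      ((P_continuous hlc hlb).comp
        (by fun_prop : Continuous fun q : (ℝ × ℝ) × EuclideanSpace ℝ (Fin d) =>
          (t - q.1.1, q.2))) (fun q => P_bound hlb _ _)
  have cD : Continuous fun p : ℝ × ℝ => D p.1 p.2 := by
    have cf : Continuous fun q : (ℝ × ℝ) × (EuclideanSpace ℝ (Fin d) × EuclideanSpace ℝ (Fin d)) =>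
        P d (t - q.1.1) (fderiv ℝ h) q.2.1 (Γ q.2.1 q.2.2) :=
      ((P_continuous hc1 hK1).comp (by fun_prop : Continuous fun q : (ℝ × ℝ) ×
        (EuclideanSpace ℝ (Fin d) × EuclideanSpace ℝ (Fin d)) => (t - q.1.1, q.2.1))).clm_apply
        (hΓc.comp continuous_snd)
    have bf : ∀ q : (ℝ × ℝ) × (EuclideanSpace ℝ (Fin d) × EuclideanSpace ℝ (Fin d)),
        ‖P d (t - q.1.1) (fderiv ℝ h) q.2.1 (Γ q.2.1 q.2.2)‖ ≤ K1 * KΓ := fun q =>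
      (ContinuousLinearMap.le_opNorm _ _).trans
        (mul_le_mul (P_bound hK1 _ _) (hΓbdd _ _) (norm_nonneg _) hK1')
    have := int_cont (Y := ℝ × ℝ) (m := fun p => (ν p.2).prod (ν p.2))
      (ProbabilityMeasure.continuous_prod.comp
        ((hν.comp continuous_snd).prodMk (hν.comp continuous_snd))) cf bf
    refine this.congr fun p => ?_
    rw [ProbabilityMeasure.toMeasure_prod, integral_prod]
    · refine integral_congr_ae (ae_of_all _ fun x => ?_)
      exact ContinuousLinearMap.integral_comp_comm (P d (t - p.1) (fderiv ℝ h) x) (iΓ p.2 x)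
    · exact Integrable.of_bound
        (cf.comp (by fun_prop : Continuous fun z => (p, z))).aestronglyMeasurable (K1 * KΓ)
        (ae_of_all _ fun z => bf (p, z))
  have props := P_props hC hK0 hK1 hK2
  -- derivative in `r`
  have dr : ∀ a r, r ∈ Set.Ioo 0 T → HasDerivAt (H a) (1 / 2 * L a r + D a r) r := by
    intro a r hr
    obtain ⟨p1, p2, p3, p4⟩ := props (t - a)
    have cB : Continuous fun s => 1 / 2 * L a s + D a s :=
      (continuous_const.mul (cL.comp (by fun_prop : Continuous fun s => (a, s)))).add
        (cD.comp (by fun_prop : Continuous fun s => (a, s)))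
    have e : ∀ u ∈ Set.Icc 0 T, H a u = H a 0 + ∫ s in (0:ℝ)..u, (1 / 2 * L a s + D a s) := by
      intro u hu
      refine (hweak _ p1 p4 u hu).trans ?_
      congr 1
      refine intervalIntegral.integral_congr fun s _ => ?_
      simp only [p2, p3]
      rw [integral_add, integral_const_mul]
      · exact (bI s (cPL _) (P_bound hlb _)).const_mul _
      · refine bI s ((cP1 _).clm_apply (cΓ s)) (K := K1 * KΓ) fun x => ?_
        exact (ContinuousLinearMap.le_opNorm _ _).trans
          (mul_le_mul (P_bound hK1 _ _) (bΓ _ _) (norm_nonneg _) hK1')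
    have d0 : HasDerivAt (fun u => H a 0 + ∫ s in (0:ℝ)..u, (1 / 2 * L a s + D a s))
        (1 / 2 * L a r + D a r) r :=
      (cB.integral_hasStrictDerivAt 0 r).hasDerivAt.const_add _
    refine d0.congr_of_eventuallyEq ?_
    filter_upwards [Ioo_mem_nhds hr.1 hr.2] with u hu
    exact e u ⟨hu.1.le, hu.2.le⟩
  -- derivative in `a`
  have da : ∀ a r, a < t → HasDerivAt (fun a => H a r) (-(1 / 2 * L a r)) a := by
    intro a r ha
    have key := hasDerivAt_integral_of_dominated_loc_of_deriv_le (μ := (ν r : Measure _))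
      (x₀ := a) (s := Set.Iio t) (F := fun a x => P d (t - a) h x)
      (F' := fun a x => -(1 / 2 * P d (t - a) (laplacian d h) x))
      (bound := fun _ => 1 / 2 * KL) (Iio_mem_nhds ha)
      (Eventually.of_forall fun b => (cP0 _).aestronglyMeasurable)
      (bI r (cP0 _) (P_bound hK0 _))
      ((continuous_const.mul (cPL _)).neg.aestronglyMeasurable)
      (ae_of_all _ fun x b _ => ?_) (integrable_const _) (ae_of_all _ fun x b hb => ?_)
    · refine key.2.congr_deriv ?_
      rw [integral_neg, integral_const_mul]
    · rw [norm_neg, norm_mul, Real.norm_of_nonneg (by norm_num : (0:ℝ) ≤ 1 / 2)]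
      exact mul_le_mul_of_nonneg_left (P_bound hlb _ _) (by norm_num)
    · have hb' : 0 < t - b := sub_pos.2 hb
      have := (P_time hC hK0 hK1 hK2 hb' x).comp b ((hasDerivAt_id b).const_sub t)
      refine HasDerivAt.congr_deriv (f := fun b => P d (t - b) h x) this ?_
      ring
  -- total derivative
  have dG : ∀ s ∈ Set.Ioo 0 t, HasDerivAt (fun s => H s s) (D s s) s := by
    intro s hs
    have hsT : s < T := hs.2.trans_le ht.2
    have key := hasStrictFDerivAt_uncurry_coprod (𝕜 := ℝ) (u := (s, s)) (f := H)
      (f₁ := fun a r => ContinuousLinearMap.toSpanSingleton ℝ (-(1 / 2 * L a r)))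
      (f₂ := fun a r => ContinuousLinearMap.toSpanSingleton ℝ (1 / 2 * L a r + D a r)) ?_ ?_ ?_ ?_
    · have h2 : HasDerivAt (fun s : ℝ => (s, s)) ((1 : ℝ), (1 : ℝ)) s :=
        (hasDerivAt_id s).prodMk (hasDerivAt_id s)
      have h3 := HasFDerivAt.comp_hasDerivAt (x := s) (f := fun s : ℝ => (s, s)) key.hasFDerivAt h2
      refine h3.congr_deriv ?_
      simp [Function.HasUncurry.uncurry]
    · have : ∀ᶠ v : ℝ × ℝ in 𝓝 (s, s), v.1 < t :=
        (continuous_fst.tendsto (s, s)).eventually (Iio_mem_nhds hs.2)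
      filter_upwards [this] with v hv
      exact (da v.1 v.2 hv).hasFDerivAt
    · have : ∀ᶠ v : ℝ × ℝ in 𝓝 (s, s), v.2 ∈ Set.Ioo 0 T :=
        (continuous_snd.tendsto (s, s)).eventually (Ioo_mem_nhds hs.1 hsT)
      filter_upwards [this] with v hv
      exact (dr v.1 v.2 hv).hasFDerivAt
    · refine Continuous.continuousAt ?_
      exact (ContinuousLinearMap.toSpanSingletonCLE (𝕜 := ℝ) (E := ℝ)).continuous.comp
        ((continuous_const.mul cL).neg)
    · refine Continuous.continuousAt ?_
      exact (ContinuousLinearMap.toSpanSingletonCLE (𝕜 := ℝ) (E := ℝ)).continuous.comp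
        ((continuous_const.mul cL).add cD)
  have cDD : Continuous fun s => D s s := cD.comp (by fun_prop : Continuous fun s => (s, s))
  have cHH : Continuous fun s => H s s := cH.comp (by fun_prop : Continuous fun s => (s, s))
  have ftc := intervalIntegral.integral_eq_sub_of_hasDerivAt_of_le ht.1 cHH.continuousOn dG
    (cDD.intervalIntegrable 0 t)
  have e1 : H t t = ∫ x, P d 0 h x ∂(ν t : Measure _) := by simp only [H, sub_self]
  have e2 : H 0 0 = ∫ x, P d t h x ∂(ν 0 : Measure _) := by simp only [H, sub_zero]
  rw [← e1, ← e2]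
  have : H t t = H 0 0 + ∫ s in (0:ℝ)..t, D s s := by linarith
  exact this

end MV

/-- Weak solutions of the McKean–Vlasov equation are weak-mild solutions: if
`μ ∈ C([0,T], 𝒫(ℝ^d))` is a weak solution of
`∂_t μ_t = ½Δμ_t - div[μ_t (Γ*μ_t)]` with `Γ` bounded Lipschitz, then for every
test function `h` of class `C²_b` (in particular for `h ∈ H^m`, `m > d/2 + 2`, and
for `h ∈ C_0^∞`) and every `t ∈ [0,T]`:
`⟨μ_t, h⟩ = ⟨μ_0, S_t h⟩ + ∫_0^t ⟨μ_s, (∇S_{t-s}h)·(Γ*μ_s)⟩ ds`. -/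
theorem stmt18 (d : ℕ) (T : ℝ) (hT : 0 < T)
    (μ : ℝ → Measure (EuclideanSpace ℝ (Fin d)))
    (hμprob : ∀ t, IsProbabilityMeasure (μ t))
    -- weak continuity of `t ↦ μ_t`:
    (hμcont : ∀ g : EuclideanSpace ℝ (Fin d) → ℝ, Continuous g → (∃ K, ∀ x, |g x| ≤ K) →
      ContinuousOn (fun t => ∫ x, g x ∂(μ t)) (Set.Icc 0 T))
    (Γ : EuclideanSpace ℝ (Fin d) → EuclideanSpace ℝ (Fin d) → EuclideanSpace ℝ (Fin d))
    (KΓ LΓ : ℝ≥0)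
    (hΓbdd : ∀ x y, ‖Γ x y‖ ≤ KΓ)
    (hΓlip : LipschitzWith LΓ fun p : EuclideanSpace ℝ (Fin d) × EuclideanSpace ℝ (Fin d) =>
      Γ p.1 p.2)
    -- μ is a weak solution of the McKean–Vlasov equation:
    (hweak : ∀ φ : EuclideanSpace ℝ (Fin d) → ℝ, ContDiff ℝ 2 φ →
      (∀ i : ℕ, i ≤ 2 → ∃ K, ∀ x, ‖iteratedFDeriv ℝ i φ x‖ ≤ K) →
      ∀ t ∈ Set.Icc (0 : ℝ) T,
        ∫ x, φ x ∂(μ t) = (∫ x, φ x ∂(μ 0)) +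
          ∫ s in (0 : ℝ)..t,
            ∫ x, (1 / 2 * laplacian d φ x
              + (fderiv ℝ φ x) (∫ y, Γ x y ∂(μ s))) ∂(μ s)) :
    ∀ h : EuclideanSpace ℝ (Fin d) → ℝ, ContDiff ℝ 2 h →
      (∀ i : ℕ, i ≤ 2 → ∃ K, ∀ x, ‖iteratedFDeriv ℝ i h x‖ ≤ K) →
      ∀ t ∈ Set.Icc (0 : ℝ) T,
        ∫ x, h x ∂(μ t) = (∫ x, heatSemigroup d t h x ∂(μ 0)) +
          ∫ s in (0 : ℝ)..t,
            ∫ x, (fderiv ℝ (heatSemigroup d (t - s) h) x) (∫ y, Γ x y ∂(μ s)) ∂(μ s) := by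
  intro h hC hb t ht
  obtain ⟨K0, hK0⟩ := hb 0 (by norm_num)
  obtain ⟨K1, hK1⟩ := hb 1 (by norm_num)
  obtain ⟨K2, hK2⟩ := hb 2 (by norm_num)
  simp only [norm_iteratedFDeriv_zero] at hK0
  have hK1' : ∀ x, ‖fderiv ℝ h x‖ ≤ K1 := fun x => by
    have := hK1 x
    rwa [← norm_iteratedFDeriv_fderiv, norm_iteratedFDeriv_zero] at this
  have hK2' : ∀ x, ‖fderiv ℝ (fderiv ℝ h) x‖ ≤ K2 := fun x => by
    have := hK2 x
    rwa [← norm_iteratedFDeriv_fderiv, ← norm_iteratedFDeriv_fderiv,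
      norm_iteratedFDeriv_zero] at this
  let ν : ℝ → ProbabilityMeasure (EuclideanSpace ℝ (Fin d)) := fun r =>
    ⟨μ (Set.projIcc 0 T hT.le r), hμprob _⟩
  have hνe : ∀ r ∈ Set.Icc 0 T, (ν r : Measure _) = μ r := fun r hr => by
    change μ (Set.projIcc 0 T hT.le r) = μ r
    rw [Set.projIcc_of_mem hT.le hr]
  have hν : Continuous ν := by
    rw [ProbabilityMeasure.continuous_iff_forall_continuous_integral]
    intro f
    have h1 := hμcont f f.continuous ⟨‖f‖, fun x => f.norm_coe_le_norm x⟩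
    exact (continuousOn_iff_continuous_domRestrict.1 h1).comp (continuous_projIcc (h := hT.le))
  have h0 : (0 : ℝ) ∈ Set.Icc 0 T := ⟨le_rfl, hT.le⟩
  have sub : ∀ t ∈ Set.Icc 0 T, ∀ s ∈ Set.uIcc 0 t, s ∈ Set.Icc 0 T := by
    intro t ht s hs
    rw [Set.uIcc_of_le ht.1] at hs
    exact ⟨hs.1, hs.2.trans ht.2⟩
  have key := MV.main T ν hν Γ KΓ hΓbdd hΓlip.continuous ?_ hC hK0 hK1' hK2' t ht
  · rw [hνe t ht, hνe 0 h0, ← MV.heat_eq le_rfl, ← MV.heat_eq ht.1] at key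
    have e0 : heatSemigroup d 0 h = h := by ext x; simp [heatSemigroup]
    rw [e0] at key
    rw [key]
    congr 1
    refine intervalIntegral.integral_congr fun s hs => ?_
    have hs' : 0 ≤ t - s := by
      rw [Set.uIcc_of_le ht.1] at hs; linarith [hs.2]
    simp only [hνe s (sub t ht s hs)]
    rw [MV.heat_eq hs', (MV.P_props hC hK0 hK1' hK2' (t - s)).2.1]
  · intro φ hφ hφb u hu
    rw [hνe u hu, hνe 0 h0, hweak φ hφ hφb u hu]
    congr 1
    refine intervalIntegral.integral_congr fun s hs => ?_
    simp only [hνe s (sub u hu s hs)]
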